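/- Let n ≥ 1, let X be a ball Banach function space over ℝⁿ with norm ρ, let 1 < p < ∞, and let N : [1,∞) → (0,∞) be an increasing function. Assume that the Hardy–Littlewood maximal operator M is bounded on X and bounded on the Köthe dual X'. Then there exists a constant C > 0 such that ‖f‖_X ≤ C‖g‖_X for every pair (f,g) ∈ F(p,N). -/

import Mathlib

open MeasureTheory ENNReal NNReal Filter Topology

noncomputable section

/-- Euclidean space ℝⁿ. -/
abbrev Eucl (n : ℕ) := EuclideanSpace ℝ (Fin n)

/-- The Hardy–Littlewood maximal operator
`M f (x) = sup_{r>0} r^{-n} ∫_{|y-x|<r} f`. -/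
def HLM {n : ℕ} (f : Eucl n → ℝ≥0∞) (x : Eucl n) : ℝ≥0∞ :=
  ⨆ (r : ℝ) (_ : 0 < r),
    (ENNReal.ofReal (r ^ n))⁻¹ * ∫⁻ y in Metric.ball x r, f y

/-- `ρ` is a ball Banach function norm over ℝⁿ: (P1)–(P5), stated on the
nonnegative (`ℝ≥0∞`-valued) measurable functions, together with compatibility
with a.e. equality (well-definedness on `L⁰`). -/
structure IsBBFN (n : ℕ) (ρ : (Eucl n → ℝ≥0∞) → ℝ≥0∞) : Prop where
  ae_congr : ∀ f g : Eucl n → ℝ≥0∞, f =ᵐ[volume] g → ρ f = ρ g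
  zero_iff : ∀ f : Eucl n → ℝ≥0∞, Measurable f → (ρ f = 0 ↔ f =ᵐ[volume] 0)
  smul : ∀ (a : ℝ≥0) (f : Eucl n → ℝ≥0∞), Measurable f →
    ρ (fun x => (a : ℝ≥0∞) * f x) = (a : ℝ≥0∞) * ρ f
  add_le : ∀ f g : Eucl n → ℝ≥0∞, Measurable f → Measurable g →
    ρ (fun x => f x + g x) ≤ ρ f + ρ g
  mono : ∀ f g : Eucl n → ℝ≥0∞, Measurable f → Measurable g →
    (∀ᵐ x ∂volume, f x ≤ g x) → ρ f ≤ ρ g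
  fatou : ∀ (fs : ℕ → Eucl n → ℝ≥0∞) (f : Eucl n → ℝ≥0∞),
    (∀ j, Measurable (fs j)) → Measurable f →
    (∀ᵐ x ∂volume, Monotone (fun j => fs j x)) →
    (∀ᵐ x ∂volume, Tendsto (fun j => fs j x) atTop (𝓝 (f x))) →
    Tendsto (fun j => ρ (fs j)) atTop (𝓝 (ρ f))
  ball_mem : ∀ (x : Eucl n) (r : ℝ), 0 < r →
    ρ (fun y => (Metric.ball x r).indicator (fun _ => (1 : ℝ≥0∞)) y) < ⊤
  ball_lower : ∀ (x : Eucl n) (r : ℝ), 0 < r → ∃ C : ℝ, 0 < C ∧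
    ∀ f : Eucl n → ℝ≥0∞, Measurable f →
      ∫⁻ y in Metric.ball x r, f y ≤ ENNReal.ofReal C * ρ f

/-- The norm `‖f‖_X = ρ(|f|)` of a real-valued function. -/
def normX {n : ℕ} (ρ : (Eucl n → ℝ≥0∞) → ℝ≥0∞) (f : Eucl n → ℝ) : ℝ≥0∞ :=
  ρ (fun x => (‖f x‖₊ : ℝ≥0∞))

/-- The Köthe dual norm `ρ'(g) = sup { ∫ f·g : ρ(f) ≤ 1 }`. -/
def kdual (n : ℕ) (ρ : (Eucl n → ℝ≥0∞) → ℝ≥0∞) : (Eucl n → ℝ≥0∞) → ℝ≥0∞ :=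
  fun g => ⨆ (f : Eucl n → ℝ≥0∞) (_ : Measurable f ∧ ρ f ≤ 1), ∫⁻ x, f x * g x

/-- The Hardy–Littlewood maximal operator is bounded on the space with norm `ρ`. -/
def MBddOn (n : ℕ) (ρ : (Eucl n → ℝ≥0∞) → ℝ≥0∞) : Prop :=
  ∃ C : ℝ, 0 < C ∧ ∀ f : Eucl n → ℝ≥0∞, Measurable f →
    ρ (HLM f) ≤ ENNReal.ofReal C * ρ f

/-- The axes-parallel closed cube with center `x` and radius `r`. -/
def cubeSet {n : ℕ} (x : Eucl n) (r : ℝ) : Set (Eucl n) :=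
  {y | ∀ i, |x i - y i| ≤ r}

/-- The Muckenhoupt `A_p` characteristic
`[w]_{A_p} = sup_Q (|Q|⁻¹∫_Q w) (|Q|⁻¹∫_Q w^{-1/(p-1)})^{p-1}`. -/
def apConst (n : ℕ) (p : ℝ) (w : Eucl n → ℝ≥0∞) : ℝ≥0∞ :=
  ⨆ (x : Eucl n) (r : ℝ) (_ : 0 < r),
    ((volume (cubeSet x r))⁻¹ * ∫⁻ y in cubeSet x r, w y) *
      ((volume (cubeSet x r))⁻¹ * ∫⁻ y in cubeSet x r, w y ^ (-(1/(p-1)))) ^ (p-1)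

/-- A weight: measurable, positive and finite a.e. -/
def IsWeight {n : ℕ} (w : Eucl n → ℝ≥0∞) : Prop :=
  Measurable w ∧ ∀ᵐ x ∂(volume : Measure (Eucl n)), 0 < w x ∧ w x < ⊤

/-- `w ∈ A_p`. -/
def MemAp (n : ℕ) (p : ℝ) (w : Eucl n → ℝ≥0∞) : Prop :=
  IsWeight w ∧ apConst n p w < ⊤

/-- The weighted Lebesgue norm, for an `ℝ≥0∞`-valued function. -/
def wLpE (n : ℕ) (p : ℝ) (w : Eucl n → ℝ≥0∞) (F : Eucl n → ℝ≥0∞) : ℝ≥0∞ :=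
  (∫⁻ x, F x ^ p * w x) ^ (1/p)

/-- The weighted Lebesgue norm `‖f‖_{L^p(w)} = (∫ |f|^p w)^{1/p}`. -/
def wLp (n : ℕ) (p : ℝ) (w : Eucl n → ℝ≥0∞) (f : Eucl n → ℝ) : ℝ≥0∞ :=
  wLpE n p w (fun x => (‖f x‖₊ : ℝ≥0∞))

/-- The extrapolation family `F(p,N)`: pairs of measurable functions `(f,g)` with
`‖f‖_{L^p(w)} ≤ N([w]_{A_p}) ‖g‖_{L^p(w)}` for every `w ∈ A_p`. -/
def memF (n : ℕ) (p : ℝ) (N : ℝ → ℝ) (f g : Eucl n → ℝ) : Prop :=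
  Measurable f ∧ Measurable g ∧
    ∀ w : Eucl n → ℝ≥0∞, MemAp n p w →
      wLp n p w f ≤ ENNReal.ofReal (N ((apConst n p w).toReal)) * wLp n p w g


lemma enorm_meas {n : ℕ} {u : Eucl n → ℝ} (hu : Measurable u) :
    Measurable (fun x => (‖u x‖₊ : ℝ≥0∞)) := by fun_prop

/-- Fatou-type lower bound. -/
lemma rho_liminf {n : ℕ} {ρ : (Eucl n → ℝ≥0∞) → ℝ≥0∞} (hρ : IsBBFN n ρ)
    (us : ℕ → Eucl n → ℝ≥0∞) (u : Eucl n → ℝ≥0∞) (hus : ∀ j, Measurable (us j))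
    (hu : Measurable u) (K : ℝ≥0∞) (hK : ∀ j, ρ (us j) ≤ K)
    (h : ∀ᵐ x ∂volume, Tendsto (fun j => us j x) atTop (𝓝 (u x))) : ρ u ≤ K := by
  have hm : ∀ k, Measurable (fun x => ⨅ j, us (j + k) x) := fun k => .iInf fun j => hus _
  have hmono : ∀ x, Monotone (fun k => ⨅ j, us (j + k) x) := by
    intro x a b hab
    refine le_iInf fun j => ?_
    refine (iInf_le _ (j + (b - a))).trans (le_of_eq ?_)
    congr 1; omega
  have ht := hρ.fatou (fun k x => ⨅ j, us (j + k) x) u hm hu (Eventually.of_forall hmono) (by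
    filter_upwards [h] with x hx
    have : u x = ⨆ k, ⨅ j, us (j + k) x := by
      rw [← hx.liminf_eq, liminf_eq_iSup_iInf_of_nat']
    rw [this]
    exact tendsto_atTop_iSup (hmono x))
  refine le_of_tendsto' ht fun k => ?_
  refine le_trans (hρ.mono _ (us k) (hm k) (hus k) (Eventually.of_forall fun x => ?_)) (hK k)
  exact (iInf_le _ 0).trans (by simp)

/-- the truncations of a nonnegative function -/
def trunc {n : ℕ} (F : Eucl n → ℝ≥0∞) (k : ℕ) (x : Eucl n) : ℝ≥0∞ :=
  (Metric.ball (0 : Eucl n) k).indicator (fun x => min (F x) k) x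

lemma trunc_meas {n : ℕ} {F : Eucl n → ℝ≥0∞} (hF : Measurable F) (k : ℕ) :
    Measurable (trunc F k) :=
  (hF.min measurable_const).indicator measurableSet_ball

lemma trunc_le {n : ℕ} (F : Eucl n → ℝ≥0∞) (k : ℕ) (x : Eucl n) : trunc F k x ≤ F x := by
  unfold trunc Set.indicator
  split_ifs <;> simp

lemma trunc_ne_top {n : ℕ} (F : Eucl n → ℝ≥0∞) (k : ℕ) (x : Eucl n) : trunc F k x ≠ ⊤ := by
  unfold trunc Set.indicator
  split_ifs <;> simp

lemma trunc_mono {n : ℕ} (F : Eucl n → ℝ≥0∞) (x : Eucl n) : Monotone (fun k => trunc F k x) := by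
  intro a b hab
  have h : (a : ℝ) ≤ b := by exact_mod_cast hab
  have h' : (a : ℝ≥0∞) ≤ b := by exact_mod_cast hab
  unfold trunc
  refine (Set.indicator_le_indicator_of_subset (Metric.ball_subset_ball h) (fun _ => bot_le) x).trans ?_
  apply Set.indicator_le_indicator
  gcongr

lemma trunc_tendsto {n : ℕ} (F : Eucl n → ℝ≥0∞) (x : Eucl n) :
    Tendsto (fun k => trunc F k x) atTop (𝓝 (F x)) := by
  have h1 : ∀ᶠ k : ℕ in atTop, trunc F k x = min (F x) k := by
    filter_upwards [tendsto_natCast_atTop_atTop.eventually_gt_atTop ‖x‖] with k hk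
    unfold trunc
    rw [Set.indicator_of_mem]
    simpa using hk
  refine Tendsto.congr' (h1.mono fun k hk => hk.symm) ?_
  have : Tendsto (fun k : ℕ => min (F x) (k : ℝ≥0∞)) atTop (𝓝 (min (F x) ⊤)) :=
    tendsto_const_nhds.min ENNReal.tendsto_nat_nhds_top
  simpa using this

lemma trunc_memLp {n : ℕ} {F : Eucl n → ℝ≥0∞} (hF : Measurable F) (k : ℕ) (s : Eucl n → ℝ)
    (hs : Measurable s) (hs1 : ∀ x, |s x| ≤ 1) :
    MemLp (fun x => (trunc F k x).toReal * s x) 2 volume := by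
  have hfin : IsFiniteMeasure (volume.restrict (Metric.ball (0 : Eucl n) k)) :=
    ⟨by simpa using measure_ball_lt_top⟩
  have : MemLp (fun x => (trunc F k x).toReal * s x) 2
      (volume.restrict (Metric.ball (0 : Eucl n) k)) := by
    refine MemLp.of_bound (by
      exact ((trunc_meas hF k).ennreal_toReal.mul hs).aestronglyMeasurable) k ?_
    refine Eventually.of_forall fun x => ?_
    have h1 : (trunc F k x).toReal ≤ k := by
      refine ENNReal.toReal_le_of_le_ofReal (by positivity) ?_
      unfold trunc Set.indicator
      split_ifs <;> simp
    rw [Real.norm_eq_abs, abs_mul, abs_of_nonneg ENNReal.toReal_nonneg]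
    calc _ ≤ (k:ℝ) * 1 := by gcongr; exact hs1 x
      _ = k := mul_one _
  rw [← memLp_indicator_iff_restrict measurableSet_ball] at this
  convert this using 1
  ext x
  by_cases hx : x ∈ Metric.ball (0 : Eucl n) k
  · simp [hx]
  · rw [Set.indicator_of_notMem hx, trunc, Set.indicator_of_notMem hx]; simp

lemma inner_trunc {n : ℕ} (h : Lp ℝ 2 (volume : Measure (Eucl n)))
    {u : Eucl n → ℝ} (hu : MemLp u 2 volume) :
    inner ℝ h (hu.toLp u) = ∫ x, u x * h x := by
  rw [L2.inner_def]
  refine integral_congr_ae ?_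
  filter_upwards [hu.coeFn_toLp] with x hx
  rw [hx]; simp

lemma integrable_trunc {n : ℕ} (h : Lp ℝ 2 (volume : Measure (Eucl n)))
    {u : Eucl n → ℝ} (hu : MemLp u 2 volume) :
    Integrable (fun x => u x * h x) :=
  hu.integrable_mul (Lp.memLp h)

/-- Lorentz--Luxemburg. -/
lemma lorentz_luxemburg {n : ℕ} {ρ : (Eucl n → ℝ≥0∞) → ℝ≥0∞} (hρ : IsBBFN n ρ)
    (F : Eucl n → ℝ≥0∞) (hF : Measurable F) (K : ℝ≥0) (hK0 : 0 < K)
    (hK : ∀ h : Eucl n → ℝ≥0∞, Measurable h → kdual n ρ h ≤ 1 → ∫⁻ x, F x * h x ≤ K) :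
    ρ F ≤ K := by
  suffices H : ∀ k, ρ (trunc F k) ≤ K from
    rho_liminf hρ (trunc F) F (trunc_meas hF) hF K H (Eventually.of_forall (trunc_tendsto F))
  intro k
  by_contra hcon
  let S : Set (Lp ℝ 2 (volume : Measure (Eucl n))) := {u | ρ (fun x => (‖u x‖₊ : ℝ≥0∞)) ≤ K}
  have lpm : ∀ u : Lp ℝ 2 (volume : Measure (Eucl n)), Measurable u :=
    fun u => (Lp.stronglyMeasurable u).measurable
  have hSconv : Convex ℝ S := by
    intro u hu v hv a b ha hb hab
    obtain ⟨α, rfl⟩ : ∃ α : ℝ≥0, (α : ℝ) = a := ⟨⟨a, ha⟩, rfl⟩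
    obtain ⟨β, rfl⟩ : ∃ β : ℝ≥0, (β : ℝ) = b := ⟨⟨b, hb⟩, rfl⟩
    change ρ _ ≤ K
    have h1 : ρ (fun x => (‖((α : ℝ) • u + (β : ℝ) • v : Lp ℝ 2 (volume : Measure (Eucl n))) x‖₊ : ℝ≥0∞)) ≤
        ρ (fun x => (α : ℝ≥0∞) * (‖u x‖₊ : ℝ≥0∞)
          + (β : ℝ≥0∞) * (‖v x‖₊ : ℝ≥0∞)) := by
      refine hρ.mono _ _ (enorm_meas (lpm _)) ?_ ?_
      · exact ((enorm_meas (lpm u)).const_mul _).add ((enorm_meas (lpm v)).const_mul _)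
      · filter_upwards [Lp.coeFn_add ((α : ℝ) • u) ((β : ℝ) • v), Lp.coeFn_smul (α : ℝ) u,
          Lp.coeFn_smul (β : ℝ) v]
          with x h1 h2 h3
        rw [h1, Pi.add_apply, h2, h3]
        norm_cast
        refine (nnnorm_add_le _ _).trans ?_
        simp only [Pi.smul_apply, nnnorm_smul]
        simp
    refine h1.trans ((hρ.add_le _ _ ((enorm_meas (lpm u)).const_mul _)
      ((enorm_meas (lpm v)).const_mul _)).trans ?_)
    rw [hρ.smul _ _ (enorm_meas (lpm u)), hρ.smul _ _ (enorm_meas (lpm v))]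
    calc _ ≤ (α : ℝ≥0∞) * K + (β : ℝ≥0∞) * K := by
          gcongr
          · exact hu
          · exact hv
      _ = ((α + β : ℝ≥0) : ℝ≥0∞) * K := by push_cast; ring
      _ = K := by
        have : α + β = 1 := by ext; exact_mod_cast hab
        rw [this]; simp
  have hSclosed : IsClosed S := by
    refine IsSeqClosed.isClosed ?_
    intro us u hus hlim
    obtain ⟨φ, -, hφ⟩ := (tendstoInMeasure_of_tendsto_Lp hlim).exists_seq_tendsto_ae
    refine rho_liminf hρ (fun j x => (‖us (φ j) x‖₊ : ℝ≥0∞)) _ (fun j => enorm_meas (lpm _))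
      (enorm_meas (lpm _)) K (fun j => hus (φ j)) ?_
    filter_upwards [hφ] with x hx
    exact ENNReal.tendsto_coe.2 (hx.nnnorm)
  have hmemF := trunc_memLp hF k (fun _ => 1) measurable_const (by simp)
  have hFS : hmemF.toLp _ ∉ S := by
    intro hin
    apply hcon
    refine le_trans (le_of_eq ?_) hin
    apply hρ.ae_congr
    filter_upwards [hmemF.coeFn_toLp] with x hx
    rw [hx]
    simp only [mul_one]
    rw [← enorm_eq_nnnorm, Real.enorm_eq_ofReal ENNReal.toReal_nonneg,
      ENNReal.ofReal_toReal (trunc_ne_top F k x)]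
  obtain ⟨φ, s, hφS, hφF⟩ := geometric_hahn_banach_closed_point hSconv hSclosed hFS
  set h := (InnerProductSpace.toDual ℝ _).symm φ with hh
  have hφ : ∀ u, φ u = inner ℝ h u := fun u => by
    rw [hh, InnerProductSpace.toDual_symm_apply]
  have hs : 0 < s := by
    have : (0 : Lp ℝ 2 (volume : Measure (Eucl n))) ∈ S := by
      change ρ _ ≤ K
      have : ρ (fun x => (‖(0 : Lp ℝ 2 (volume : Measure (Eucl n))) x‖₊ : ℝ≥0∞)) = 0 := by
        rw [hρ.zero_iff _ (enorm_meas (lpm _))]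
        filter_upwards [Lp.coeFn_zero ℝ 2 (volume : Measure (Eucl n))] with x hx
        rw [hx]; simp
      rw [this]; exact bot_le
    simpa using hφS 0 this
  have key : ∀ v : Eucl n → ℝ≥0∞, Measurable v → ρ v ≤ K →
      ∫⁻ x, v x * (‖h x‖₊ : ℝ≥0∞) ≤ ENNReal.ofReal s := by
    intro v hv hvK
    have hj : ∀ j, ∫⁻ x, trunc v j x * (‖h x‖₊ : ℝ≥0∞) ≤ ENNReal.ofReal s := by
      intro j
      let sg : Eucl n → ℝ := fun x => SignType.sign (h x)
      have hsg : Measurable sg := by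
        have : sg = fun x => if 0 < h x then 1 else if h x < 0 then -1 else 0 := by
          ext x; simp only [sg, sign_apply]; split_ifs <;> simp
        rw [this]
        exact Measurable.ite (measurableSet_lt measurable_const (lpm h)) measurable_const
          (Measurable.ite (measurableSet_lt (lpm h) measurable_const) measurable_const
            measurable_const)
      have hsg1 : ∀ x, |sg x| ≤ 1 := by
        intro x; simp only [sg, sign_apply]; split_ifs <;> simp
      have hsgh : ∀ x, sg x * h x = |h x| := fun x => sign_mul_self _
      have hm := trunc_memLp hv j sg hsg hsg1
      have hin : hm.toLp _ ∈ S := by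
        change ρ _ ≤ K
        refine le_trans (hρ.mono _ _ (enorm_meas (lpm _)) hv ?_) hvK
        filter_upwards [hm.coeFn_toLp] with x hx
        rw [hx, nnnorm_mul, ENNReal.coe_mul]
        refine le_trans ?_ (trunc_le v j x)
        calc _ ≤ (‖(trunc v j x).toReal‖₊ : ℝ≥0∞) * 1 := by
              gcongr
              have := hsg1 x
              rw [← Real.norm_eq_abs] at this
              exact_mod_cast this
          _ = trunc v j x := by
            rw [mul_one, ← enorm_eq_nnnorm, Real.enorm_eq_ofReal ENNReal.toReal_nonneg,
              ENNReal.ofReal_toReal (trunc_ne_top v j x)]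
      have h1 := hφS _ hin
      rw [hφ, inner_trunc] at h1
      have h2 : ∫⁻ x, trunc v j x * (‖h x‖₊ : ℝ≥0∞) =
          ENNReal.ofReal (∫ x, (trunc v j x).toReal * sg x * h x) := by
        rw [ofReal_integral_eq_lintegral_ofReal (integrable_trunc h hm)]
        · refine lintegral_congr fun x => ?_
          rw [mul_assoc, hsgh, ENNReal.ofReal_mul ENNReal.toReal_nonneg,
            ENNReal.ofReal_toReal (trunc_ne_top v j x), ← Real.norm_eq_abs, ofReal_norm,
            enorm_eq_nnnorm]
        · refine Eventually.of_forall fun x => ?_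
          simp only [Pi.zero_apply]
          rw [mul_assoc, hsgh]; positivity
      rw [h2]
      exact ENNReal.ofReal_le_ofReal h1.le
    have ht := lintegral_tendsto_of_tendsto_of_monotone (μ := volume)
      (f := fun j x => trunc v j x * (‖h x‖₊ : ℝ≥0∞))
      (F := fun x => v x * (‖h x‖₊ : ℝ≥0∞))
      (fun j => ((trunc_meas hv j).mul (enorm_meas (lpm h))).aemeasurable)
      (Eventually.of_forall fun x a b hab => by
        dsimp only; gcongr; exact trunc_mono v x hab)
      (Eventually.of_forall fun x =>
        ENNReal.Tendsto.mul_const (trunc_tendsto v x) (Or.inr (by simp)))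
    exact le_of_tendsto' ht hj
  have hs0 : ENNReal.ofReal s ≠ 0 := by simpa using hs
  have hsT : ENNReal.ofReal s ≠ ⊤ := ENNReal.ofReal_ne_top
  have hK0' : (K : ℝ≥0∞) ≠ 0 := by simpa using hK0.ne'
  let h' : Eucl n → ℝ≥0∞ := fun x => (K / ENNReal.ofReal s) * (‖h x‖₊ : ℝ≥0∞)
  have hh'm : Measurable h' := (enorm_meas (lpm h)).const_mul _
  have hd : kdual n ρ h' ≤ 1 := by
    refine iSup₂_le fun v hv => ?_
    have h3 := key (fun x => K * v x) (hv.1.const_mul _) (by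
      rw [hρ.smul K v hv.1]
      calc _ ≤ (K : ℝ≥0∞) * 1 := by gcongr; exact hv.2
        _ = K := mul_one _)
    calc ∫⁻ x, v x * h' x = ∫⁻ x, (ENNReal.ofReal s)⁻¹ * (K * v x * (‖h x‖₊ : ℝ≥0∞)) := by
          refine lintegral_congr fun x => ?_
          simp only [h', div_eq_mul_inv]; ring
      _ = (ENNReal.ofReal s)⁻¹ * ∫⁻ x, (K * v x * (‖h x‖₊ : ℝ≥0∞)) := by
          rw [lintegral_const_mul]
          exact ((hv.1.const_mul _).mul (enorm_meas (lpm h)))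
      _ ≤ (ENNReal.ofReal s)⁻¹ * ENNReal.ofReal s := by gcongr
      _ = 1 := ENNReal.inv_mul_cancel hs0 hsT
  have h4 := hK h' hh'm hd
  have h5 : ENNReal.ofReal s < ∫⁻ x, F x * (‖h x‖₊ : ℝ≥0∞) := by
    rw [hφ, inner_trunc] at hφF
    calc ENNReal.ofReal s < ENNReal.ofReal (∫ x, (trunc F k x).toReal * 1 * h x) :=
          (ENNReal.ofReal_lt_ofReal_iff (hs.trans hφF)).2 hφF
      _ ≤ ∫⁻ x, ENNReal.ofReal ((trunc F k x).toReal * 1 * h x) := by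
        refine ENNReal.ofReal_le_of_le_toReal ?_
        rw [integral_eq_lintegral_pos_part_sub_lintegral_neg_part (integrable_trunc h hmemF)]
        linarith [@ENNReal.toReal_nonneg (∫⁻ x, ENNReal.ofReal (-((trunc F k x).toReal * 1 * h x)))]
      _ ≤ ∫⁻ x, F x * (‖h x‖₊ : ℝ≥0∞) := by
        refine lintegral_mono fun x => ?_
        dsimp only
        rw [mul_one, ENNReal.ofReal_mul ENNReal.toReal_nonneg,
            ENNReal.ofReal_toReal (trunc_ne_top F k x)]
        gcongr
        · exact trunc_le F k x
        · rw [← enorm_eq_nnnorm]; exact Real.ofReal_le_enorm _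
  have h6 : ∫⁻ x, F x * h' x = (K / ENNReal.ofReal s) * ∫⁻ x, F x * (‖h x‖₊ : ℝ≥0∞) := by
    rw [← lintegral_const_mul (f := fun x => F x * (‖h x‖₊ : ℝ≥0∞)) _
      (hF.mul (enorm_meas (lpm h)))]
    refine lintegral_congr fun x => ?_
    simp only [h']; ring
  rw [h6] at h4
  have h7 : (K / ENNReal.ofReal s) * ENNReal.ofReal s < K := by
    refine lt_of_lt_of_le ?_ h4
    refine ENNReal.mul_lt_mul_right ?_ ?_ h5
    · exact (ENNReal.div_pos hK0' hsT).ne'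
    · exact ENNReal.div_ne_top (by simp) hs0
  rw [ENNReal.div_mul_cancel hs0 hsT] at h7
  exact lt_irrefl _ h7

lemma HLM_measurable {n : ℕ} (f : Eucl n → ℝ≥0∞) : Measurable (HLM f) := by
  apply LowerSemicontinuous.measurable
  unfold HLM
  refine lowerSemicontinuous_iSup fun r => lowerSemicontinuous_iSup fun hr => ?_
  intro x t ht
  have hU : Metric.ball x r = ⋃ k : ℕ, Metric.ball x (r - 1 / ((k : ℝ) + 1)) := by
    ext y
    simp only [Metric.mem_ball, Set.mem_iUnion]
    constructor
    · intro h
      obtain ⟨k, hk⟩ := exists_nat_one_div_lt (sub_pos.2 h)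
      exact ⟨k, by linarith⟩
    · rintro ⟨k, hk⟩
      have : (0:ℝ) < 1 / ((k : ℝ) + 1) := by positivity
      linarith
  have hdir : Directed (fun x1 x2 => x1 ⊆ x2)
      (fun k : ℕ => Metric.ball x (r - 1 / ((k : ℝ) + 1))) := by
    apply Monotone.directed_le
    intro a b hab
    apply Metric.ball_subset_ball
    have := Nat.one_div_le_one_div (α := ℝ) hab
    linarith
  change t < (ENNReal.ofReal (r ^ n))⁻¹ * ∫⁻ (y : Eucl n) in Metric.ball x r, f y at ht
  rw [hU, setLIntegral_iUnion_of_directed _ hdir, ENNReal.mul_iSup, lt_iSup_iff] at ht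
  obtain ⟨k, hk⟩ := ht
  have hpos : (0:ℝ) < 1 / ((k : ℝ) + 1) := by positivity
  filter_upwards [Metric.ball_mem_nhds x hpos] with y hy
  refine lt_of_lt_of_le hk ?_
  gcongr
  intro z hz
  simp only [Metric.mem_ball] at hy hz ⊢
  have := dist_triangle z x y
  rw [dist_comm x y] at this
  linarith

lemma HLM_tsum {n : ℕ} (fs : ℕ → Eucl n → ℝ≥0∞) (hfs : ∀ k, Measurable (fs k)) (x : Eucl n) :
    HLM (fun y => ∑' k, fs k y) x ≤ ∑' k, HLM (fs k) x := by
  refine iSup₂_le fun r hr => ?_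
  rw [lintegral_tsum (fun k => (hfs k).aemeasurable), ← ENNReal.tsum_mul_left]
  refine ENNReal.tsum_le_tsum fun k => ?_
  exact le_iSup₂ (f := fun (r : ℝ) (_ : 0 < r) =>
    (ENNReal.ofReal (r ^ n))⁻¹ * ∫⁻ y in Metric.ball x r, fs k y) r hr

lemma HLM_const_mul {n : ℕ} (f : Eucl n → ℝ≥0∞) (hf : Measurable f) (c : ℝ≥0∞) (x : Eucl n) :
    HLM (fun y => c * f y) x = c * HLM f x := by
  unfold HLM
  simp only [ENNReal.mul_iSup]
  refine iSup_congr fun r => iSup_congr fun hr => ?_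
  rw [lintegral_const_mul _ hf]; ring

lemma HLM_pos {n : ℕ} (f : Eucl n → ℝ≥0∞) (hf : Measurable f) (h0 : ¬ f =ᵐ[volume] 0)
    (x : Eucl n) : HLM f x ≠ 0 := by
  intro h
  apply h0
  have h1 : ∀ k : ℕ, ∫⁻ y in Metric.ball x ((k : ℝ) + 1), f y = 0 := by
    intro k
    have hk : (0:ℝ) < (k : ℝ) + 1 := by positivity
    have := (iSup₂_le_iff.1 h.le) _ hk
    rw [nonpos_iff_eq_zero, mul_eq_zero] at this
    rcases this with h | h
    · simp at h
    · exact h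
  have hU : (⋃ k : ℕ, Metric.ball x ((k : ℝ) + 1)) = Set.univ := by
    refine Set.eq_univ_of_forall fun y => ?_
    obtain ⟨k, hk⟩ := exists_nat_gt (dist y x)
    exact Set.mem_iUnion.2 ⟨k, by simp only [Metric.mem_ball]; linarith⟩
  have hdir : Directed (fun x1 x2 => x1 ⊆ x2)
      (fun k : ℕ => Metric.ball x ((k : ℝ) + 1)) := by
    apply Monotone.directed_le
    intro a b hab
    apply Metric.ball_subset_ball
    have : (a : ℝ) ≤ b := by exact_mod_cast hab
    linarith
  have h2 := setLIntegral_iUnion_of_directed (μ := volume) f hdir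
  rw [hU, setLIntegral_univ] at h2
  simp only [h1, iSup_const] at h2
  exact (lintegral_eq_zero_iff hf).1 (by simpa using h2)

/-- the Rubio de Francia algorithm -/
def RdF {n : ℕ} (D : ℝ≥0) (g : Eucl n → ℝ≥0∞) (x : Eucl n) : ℝ≥0∞ :=
  ∑' k : ℕ, (((2 * D)⁻¹ ^ k : ℝ≥0) : ℝ≥0∞) * (HLM^[k] g) x

lemma iter_meas {n : ℕ} {g : Eucl n → ℝ≥0∞} (hg : Measurable g) (k : ℕ) :
    Measurable (HLM^[k] g) := by
  cases k with
  | zero => exact hg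
  | succ k => rw [Function.iterate_succ_apply']; exact HLM_measurable _

lemma RdF_meas {n : ℕ} (D : ℝ≥0) {g : Eucl n → ℝ≥0∞} (hg : Measurable g) :
    Measurable (RdF D g) :=
  Measurable.tsum fun k => (iter_meas hg k).const_mul _

lemma le_RdF {n : ℕ} (D : ℝ≥0) (g : Eucl n → ℝ≥0∞) (x : Eucl n) : g x ≤ RdF D g x := by
  refine le_trans (by simp) (ENNReal.le_tsum 0)

lemma HLM_RdF {n : ℕ} (D : ℝ≥0) (hD : 0 < D) {g : Eucl n → ℝ≥0∞} (hg : Measurable g)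
    (x : Eucl n) : HLM (RdF D g) x ≤ ((2 * D : ℝ≥0) : ℝ≥0∞) * RdF D g x := by
  refine (HLM_tsum _ (fun k => (iter_meas hg k).const_mul _) x).trans ?_
  have h1 : ∀ k, HLM (fun y => (((2 * D)⁻¹ ^ k : ℝ≥0) : ℝ≥0∞) * (HLM^[k] g) y) x
      = ((2 * D : ℝ≥0) : ℝ≥0∞) * ((((2 * D)⁻¹ ^ (k+1) : ℝ≥0) : ℝ≥0∞) * (HLM^[k+1] g) x) := by
    intro k
    rw [HLM_const_mul _ (iter_meas hg k), Function.iterate_succ_apply', ← mul_assoc,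
      ← ENNReal.coe_mul]
    congr 2
    have h2 : 2 * D ≠ 0 := by positivity
    rw [pow_succ', ← mul_assoc, mul_inv_cancel₀ h2, one_mul]
  rw [tsum_congr h1, ENNReal.tsum_mul_left]
  gcongr
  exact ENNReal.tsum_comp_le_tsum_of_injective (add_left_injective 1)
    (fun k => (((2 * D)⁻¹ ^ k : ℝ≥0) : ℝ≥0∞) * (HLM^[k] g) x)

lemma RdF_pos {n : ℕ} (D : ℝ≥0) (hD : 0 < D) {g : Eucl n → ℝ≥0∞} (hg : Measurable g)
    (h0 : ¬ g =ᵐ[volume] 0) (x : Eucl n) : RdF D g x ≠ 0 := by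
  intro h
  have := ENNReal.tsum_eq_zero.1 h 1
  simp only [pow_one, Function.iterate_one, mul_eq_zero] at this
  rcases this with h | h
  · simp [hD.ne'] at h
  · exact HLM_pos g hg h0 x h

lemma RdF_bound {n : ℕ} (ρ : (Eucl n → ℝ≥0∞) → ℝ≥0∞) (D : ℝ≥0) (hD : 0 < D)
    (hs : ∀ (a : ℝ≥0) (f : Eucl n → ℝ≥0∞), Measurable f →
      ρ (fun x => (a : ℝ≥0∞) * f x) ≤ (a : ℝ≥0∞) * ρ f)
    (hsum : ∀ fs : ℕ → Eucl n → ℝ≥0∞, (∀ k, Measurable (fs k)) →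
      ρ (fun x => ∑' k, fs k x) ≤ ∑' k, ρ (fs k))
    (hM : ∀ f, Measurable f → ρ (HLM f) ≤ D * ρ f)
    (g : Eucl n → ℝ≥0∞) (hg : Measurable g) : ρ (RdF D g) ≤ 2 * ρ g := by
  have hit : ∀ k, ρ (HLM^[k] g) ≤ (D : ℝ≥0∞) ^ k * ρ g := by
    intro k
    induction k with
    | zero => simp
    | succ k ih =>
      rw [Function.iterate_succ_apply']
      refine (hM _ (iter_meas hg k)).trans ?_
      calc _ ≤ (D : ℝ≥0∞) * ((D : ℝ≥0∞) ^ k * ρ g) := by gcongr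
        _ = _ := by ring
  refine (hsum _ (fun k => (iter_meas hg k).const_mul _)).trans ?_
  calc _ ≤ ∑' k : ℕ, (2⁻¹ : ℝ≥0∞) ^ k * ρ g := by
        refine ENNReal.tsum_le_tsum fun k => ?_
        refine (hs _ _ (iter_meas hg k)).trans ?_
        calc _ ≤ (((2 * D)⁻¹ ^ k : ℝ≥0) : ℝ≥0∞) * ((D : ℝ≥0∞) ^ k * ρ g) := by
              gcongr; exact hit k
          _ = (((2 * D)⁻¹ ^ k * D ^ k : ℝ≥0) : ℝ≥0∞) * ρ g := by push_cast; ring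
          _ = ((2⁻¹ ^ k : ℝ≥0) : ℝ≥0∞) * ρ g := by
            rw [← mul_pow]
            congr 3
            field_simp
          _ = _ := by
            rw [ENNReal.coe_pow, ENNReal.coe_inv (by norm_num)]; norm_num
    _ = 2 * ρ g := by
      rw [ENNReal.tsum_mul_right, ENNReal.tsum_geometric, ENNReal.one_sub_inv_two, inv_inv]

lemma rho_tsum {n : ℕ} {ρ : (Eucl n → ℝ≥0∞) → ℝ≥0∞} (hρ : IsBBFN n ρ)
    (fs : ℕ → Eucl n → ℝ≥0∞) (hfs : ∀ k, Measurable (fs k)) :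
    ρ (fun x => ∑' k, fs k x) ≤ ∑' k, ρ (fs k) := by
  have hm : ∀ N, Measurable (fun x => ∑ k ∈ Finset.range N, fs k x) := fun N =>
    Finset.measurable_fun_sum _ fun k _ => hfs k
  refine rho_liminf hρ (fun N x => ∑ k ∈ Finset.range N, fs k x) _ hm
    (Measurable.tsum hfs) _ ?_
    (Eventually.of_forall fun x => ENNReal.summable.hasSum.tendsto_sum_nat)
  intro N
  refine le_trans ?_ (ENNReal.sum_le_tsum (Finset.range N))
  induction N with
  | zero =>
    simp only [Finset.range_zero, Finset.sum_empty, nonpos_iff_eq_zero]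
    rw [hρ.zero_iff _ measurable_const]; rfl
  | succ N ih =>
    simp only [Finset.sum_range_succ]
    refine (hρ.add_le _ _ (hm N) (hfs N)).trans ?_
    gcongr

lemma kdual_tsum {n : ℕ} (ρ : (Eucl n → ℝ≥0∞) → ℝ≥0∞)
    (fs : ℕ → Eucl n → ℝ≥0∞) (hfs : ∀ k, Measurable (fs k)) :
    kdual n ρ (fun x => ∑' k, fs k x) ≤ ∑' k, kdual n ρ (fs k) := by
  refine iSup₂_le fun f hf => ?_
  simp only [← ENNReal.tsum_mul_left]
  rw [lintegral_tsum (f := fun k x => f x * fs k x) (fun k => (hf.1.mul (hfs k)).aemeasurable)]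
  refine ENNReal.tsum_le_tsum fun k => ?_
  exact le_iSup₂ (f := fun (f : Eucl n → ℝ≥0∞) (_ : Measurable f ∧ ρ f ≤ 1) =>
    ∫⁻ x, f x * fs k x) f hf

lemma kdual_smul {n : ℕ} (ρ : (Eucl n → ℝ≥0∞) → ℝ≥0∞) (a : ℝ≥0)
    (g : Eucl n → ℝ≥0∞) (hg : Measurable g) :
    kdual n ρ (fun x => (a : ℝ≥0∞) * g x) ≤ a * kdual n ρ g := by
  refine iSup₂_le fun f hf => ?_
  have : ∫⁻ x, f x * (a * g x) = a * ∫⁻ x, f x * g x := by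
    rw [← lintegral_const_mul (f := fun x => f x * g x) _ (hf.1.mul hg)]
    refine lintegral_congr fun x => by ring
  rw [this]
  gcongr
  exact le_iSup₂ (f := fun (f : Eucl n → ℝ≥0∞) (_ : Measurable f ∧ ρ f ≤ 1) =>
    ∫⁻ x, f x * g x) f hf

lemma holder_kdual {n : ℕ} {ρ : (Eucl n → ℝ≥0∞) → ℝ≥0∞} (hρ : IsBBFN n ρ)
    (f g : Eucl n → ℝ≥0∞) (hf : Measurable f) (hg : Measurable g) (hfin : ρ f ≠ ⊤) :
    ∫⁻ x, f x * g x ≤ ρ f * kdual n ρ g := by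
  by_cases h0 : ρ f = 0
  · rw [h0, zero_mul, nonpos_iff_eq_zero]
    rw [lintegral_eq_zero_iff (f := fun x => f x * g x) (hf.mul hg)]
    filter_upwards [(hρ.zero_iff f hf).1 h0] with x hx
    simp [hx]
  obtain ⟨r, hr⟩ : ∃ r : ℝ≥0, (r : ℝ≥0∞) = ρ f := ⟨_, ENNReal.coe_toNNReal hfin⟩
  have hr0 : r ≠ 0 := by rintro rfl; simp at hr; exact h0 hr.symm
  have h1 : ∫⁻ x, ((r⁻¹ : ℝ≥0) : ℝ≥0∞) * f x * g x ≤ kdual n ρ g := by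
    refine le_iSup₂ (f := fun (f : Eucl n → ℝ≥0∞) (_ : Measurable f ∧ ρ f ≤ 1) =>
      ∫⁻ x, f x * g x) (fun x => ((r⁻¹ : ℝ≥0) : ℝ≥0∞) * f x) ⟨hf.const_mul _, ?_⟩
    rw [hρ.smul _ _ hf, ← hr, ← ENNReal.coe_mul, inv_mul_cancel₀ hr0]; simp
  calc ∫⁻ x, f x * g x = ∫⁻ x, r * (((r⁻¹ : ℝ≥0) : ℝ≥0∞) * f x * g x) := by
        refine lintegral_congr fun x => ?_
        rw [← mul_assoc, ← mul_assoc, ← ENNReal.coe_mul, mul_inv_cancel₀ hr0]; simp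
    _ = r * ∫⁻ x, ((r⁻¹ : ℝ≥0) : ℝ≥0∞) * f x * g x :=
        lintegral_const_mul _ ((hf.const_mul _).mul hg)
    _ ≤ _ := by rw [hr]; gcongr

lemma cube_vol {n : ℕ} (x : Eucl n) (r : ℝ) :
    volume (cubeSet x r) = ENNReal.ofReal (2 * r) ^ n := by
  have h : cubeSet x r = WithLp.ofLp ⁻¹' (Set.Icc (fun i => x i - r) (fun i => x i + r)) := by
    ext y
    simp only [cubeSet, Set.mem_ofPred_eq, Set.mem_preimage, Set.mem_Icc, Pi.le_def, abs_le]
    constructor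
    · intro h
      exact ⟨fun i => by linarith [(h i).2], fun i => by linarith [(h i).1]⟩
    · intro h i
      constructor
      · linarith [h.2 i]
      · linarith [h.1 i]
  rw [h, (PiLp.volume_preserving_ofLp (Fin n)).measure_preimage
    measurableSet_Icc.nullMeasurableSet, Real.volume_Icc_pi]
  have : ∀ i, x i + r - (x i - r) = 2 * r := fun i => by ring
  simp [this]

lemma cube_meas {n : ℕ} (x : Eucl n) (r : ℝ) : MeasurableSet (cubeSet x r) := by
  have : cubeSet x r = ⋂ i, {y : Eucl n | |x i - y i| ≤ r} := by
    ext y; simp [cubeSet]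
  rw [this]
  refine MeasurableSet.iInter fun i => measurableSet_le ?_ measurable_const
  fun_prop

lemma cube_subset {n : ℕ} (x : Eucl n) (r : ℝ) (hr : 0 < r) {y : Eucl n} (hy : y ∈ cubeSet x r) :
    cubeSet x r ⊆ Metric.ball y (2 * r * (n + 1)) := by
  intro z hz
  rw [Metric.mem_ball, EuclideanSpace.dist_eq, Real.sqrt_lt' (by positivity)]
  calc ∑ i, dist (z i) (y i) ^ 2 ≤ ∑ i : Fin n, (2 * r) ^ 2 := by
        refine Finset.sum_le_sum fun i _ => ?_
        gcongr
        rw [Real.dist_eq]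
        have h1 := abs_le.1 (hy i)
        have h2 := abs_le.1 (hz i)
        rw [abs_le]
        constructor <;> linarith
    _ = n * (2 * r) ^ 2 := by simp
    _ < (2 * r * (n + 1)) ^ 2 := by
        have : (0:ℝ) < (2 * r) ^ 2 := by positivity
        have hn : (0:ℝ) ≤ n := by positivity
        nlinarith [mul_nonneg hn hn, mul_nonneg this.le hn, mul_nonneg this.le (mul_nonneg hn hn)]

lemma cube_avg {n : ℕ} (G : Eucl n → ℝ≥0∞) (a : ℝ≥0∞)
    (hG : ∀ x, HLM G x ≤ a * G x) (x : Eucl n) (r : ℝ) (hr : 0 < r) {y : Eucl n}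
    (hy : y ∈ cubeSet x r) :
    (volume (cubeSet x r))⁻¹ * ∫⁻ z in cubeSet x r, G z ≤ ((n : ℝ≥0∞) + 1) ^ n * a * G y := by
  have hR : 0 < 2 * r * ((n : ℝ) + 1) := by positivity
  have h1 : (ENNReal.ofReal ((2 * r * ((n : ℝ) + 1)) ^ n))⁻¹ *
      ∫⁻ z in Metric.ball y (2 * r * (n + 1)), G z ≤ a * G y := by
    refine le_trans ?_ (hG y)
    exact le_iSup₂ (f := fun (r : ℝ) (_ : 0 < r) =>
      (ENNReal.ofReal (r ^ n))⁻¹ * ∫⁻ z in Metric.ball y r, G z) _ hR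
  have h2 : (volume (cubeSet x r))⁻¹ = ((n : ℝ≥0∞) + 1) ^ n *
      (ENNReal.ofReal ((2 * r * ((n : ℝ) + 1)) ^ n))⁻¹ := by
    have e : ENNReal.ofReal ((n : ℝ) + 1) = (n : ℝ≥0∞) + 1 := by
      rw [ENNReal.ofReal_add (by positivity) (by norm_num)]; simp
    have e0 : ((n : ℝ≥0∞) + 1) ^ n ≠ 0 := by positivity
    have eT : ((n : ℝ≥0∞) + 1) ^ n ≠ ⊤ := ENNReal.pow_ne_top (by simp)
    rw [cube_vol, ENNReal.ofReal_pow hR.le, ENNReal.ofReal_mul (p := 2 * r) (by positivity), e, mul_pow,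
      ENNReal.mul_inv (Or.inr eT) (Or.inr e0), mul_comm _ ((((n : ℝ≥0∞) + 1) ^ n)⁻¹), ← mul_assoc,
      ENNReal.mul_inv_cancel e0 eT, one_mul]
  rw [h2, mul_assoc, mul_assoc (((n : ℝ≥0∞) + 1) ^ n) a]
  gcongr ((n : ℝ≥0∞) + 1) ^ n * ?_
  refine le_trans ?_ h1
  gcongr
  exact cube_subset x r hr hy

lemma inv_bound {γ A t : ℝ≥0∞} {q : ℝ} (hq : 0 < q) (hA0 : A ≠ 0) (hAT : A ≠ ⊤)
    (h : γ ≤ A * t) : t ^ (-q) ≤ A ^ q * γ ^ (-q) := by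
  have h0 : A ^ q ≠ 0 := by simp [ENNReal.rpow_eq_zero_iff, hA0, hAT]
  have hT : A ^ q ≠ ⊤ := ENNReal.rpow_ne_top_of_nonneg hq.le hAT
  have h1 : γ ^ q ≤ A ^ q * t ^ q := by
    rw [← ENNReal.mul_rpow_of_nonneg _ _ hq.le]; gcongr
  have h2 := ENNReal.inv_le_inv.2 h1
  rw [ENNReal.mul_inv (Or.inl h0) (Or.inl hT)] at h2
  rw [ENNReal.rpow_neg, ENNReal.rpow_neg]
  calc (t ^ q)⁻¹ = A ^ q * ((A ^ q)⁻¹ * (t ^ q)⁻¹) := by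
        rw [← mul_assoc, ENNReal.mul_inv_cancel h0 hT, one_mul]
    _ ≤ _ := by gcongr

lemma ap_bound {n : ℕ} {p : ℝ} (hp : 1 < p) (G H : Eucl n → ℝ≥0∞) (hGm : Measurable G)
    (hHm : Measurable H) (a b : ℝ≥0) (ha : 0 < a) (hb : 0 < b)
    (hG : ∀ x, HLM G x ≤ a * G x) (hH : ∀ x, HLM H x ≤ b * H x)
    (hG0 : ∀ x, G x ≠ 0) (hH0 : ∀ x, H x ≠ 0)
    (hGT : ∀ᵐ x ∂volume, G x ≠ ⊤) (hHT : ∀ᵐ x ∂volume, H x ≠ ⊤) :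
    apConst n p (fun x => G x ^ (1 - p) * H x) ≤
      (((n : ℝ≥0∞) + 1) ^ n * a) ^ (p - 1) * (((n : ℝ≥0∞) + 1) ^ n * b) := by
  refine iSup_le fun x => iSup₂_le fun r hr => ?_
  have hq : 0 < p - 1 := by linarith
  have hQm := cube_meas x r
  have hV0 : volume (cubeSet x r) ≠ 0 := by
    rw [cube_vol]; exact pow_ne_zero _ (by simpa using hr)
  have hVT : volume (cubeSet x r) ≠ ⊤ := by
    rw [cube_vol]; exact ENNReal.pow_ne_top ENNReal.ofReal_ne_top
  have e0 : ((n : ℝ≥0∞) + 1) ^ n ≠ 0 := by positivity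
  have eT : ((n : ℝ≥0∞) + 1) ^ n ≠ ⊤ := ENNReal.pow_ne_top (by simp)
  set A : ℝ≥0∞ := ((n : ℝ≥0∞) + 1) ^ n * a with hA
  set B : ℝ≥0∞ := ((n : ℝ≥0∞) + 1) ^ n * b with hB
  have hA0 : A ≠ 0 := mul_ne_zero e0 (by simpa using ha.ne')
  have hB0 : B ≠ 0 := mul_ne_zero e0 (by simpa using hb.ne')
  have hAT : A ≠ ⊤ := ENNReal.mul_ne_top eT (by simp)
  have hBT : B ≠ ⊤ := ENNReal.mul_ne_top eT (by simp)
  set Q := cubeSet x r with hQ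
  set V := volume Q with hV
  have aux : ∀ (K : Eucl n → ℝ≥0∞), Measurable K → (∀ x, K x ≠ 0) → (∀ᵐ x ∂volume, K x ≠ ⊤) →
      ∀ c : ℝ≥0∞, c ≠ ⊤ → (∀ y ∈ Q, V⁻¹ * ∫⁻ z in Q, K z ≤ c * K y) →
      V⁻¹ * ∫⁻ z in Q, K z ≠ 0 ∧ V⁻¹ * ∫⁻ z in Q, K z ≠ ⊤ := by
    intro K hKm hK0 hKT c hc hK
    constructor
    · refine mul_ne_zero (ENNReal.inv_ne_zero.2 hVT) ?_
      refine ((setLIntegral_pos_iff hKm).2 ?_).ne'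
      have : Function.support K = Set.univ := Set.eq_univ_of_forall fun x => hK0 x
      rw [this, Set.univ_inter]
      exact pos_iff_ne_zero.2 hV0
    · have : ∃ y ∈ Q, K y ≠ ⊤ := by
        by_contra hcon
        push Not at hcon
        apply hV0
        exact measure_mono_null (fun y hy => by simpa using hcon y hy) hKT
      obtain ⟨y, hy, hyT⟩ := this
      exact ne_top_of_le_ne_top (ENNReal.mul_ne_top hc hyT) (hK y hy)
  have hGavg : ∀ y ∈ Q, V⁻¹ * ∫⁻ z in Q, G z ≤ A * G y := fun y hy => cube_avg G a hG x r hr hy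
  have hHavg : ∀ y ∈ Q, V⁻¹ * ∫⁻ z in Q, H z ≤ B * H y := fun y hy => cube_avg H b hH x r hr hy
  obtain ⟨hγ0, hγT⟩ := aux G hGm hG0 hGT A hAT hGavg
  obtain ⟨hη0, hηT⟩ := aux H hHm hH0 hHT B hBT hHavg
  set γ := V⁻¹ * ∫⁻ z in Q, G z with hγ
  set η := V⁻¹ * ∫⁻ z in Q, H z with hη
  have h1 : V⁻¹ * ∫⁻ y in Q, G y ^ (1 - p) * H y ≤ A ^ (p - 1) * γ ^ (-(p - 1)) * η := by
    calc _ ≤ V⁻¹ * ∫⁻ y in Q, A ^ (p - 1) * γ ^ (-(p - 1)) * H y := by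
          gcongr 1
          refine setLIntegral_mono' hQm fun y hy => ?_
          gcongr
          have := inv_bound hq hA0 hAT (hGavg y hy)
          rwa [show -(p - 1) = 1 - p by ring] at this ⊢
      _ = _ := by
        rw [lintegral_const_mul _ hHm, hη]; ring
  have hq' : 0 < 1 / (p - 1) := by positivity
  have h2 : V⁻¹ * ∫⁻ y in Q, (G y ^ (1 - p) * H y) ^ (-(1 / (p - 1))) ≤
      B ^ (1 / (p - 1)) * η ^ (-(1 / (p - 1))) * γ := by
    calc _ ≤ V⁻¹ * ∫⁻ y in Q, B ^ (1 / (p - 1)) * η ^ (-(1 / (p - 1))) * G y := by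
          gcongr 1
          refine setLIntegral_mono_ae' hQm ?_
          filter_upwards [hGT, hHT] with y hy1 hy2 hy
          have := inv_bound hq' hB0 hBT (hHavg y hy)
          have e : (G y ^ (1 - p) * H y) ^ (-(1 / (p - 1))) = G y * H y ^ (-(1 / (p - 1))) := by
            rw [ENNReal.mul_rpow_of_ne_zero _ (hH0 y), ← ENNReal.rpow_mul]
            · have : (1 - p) * (-(1 / (p - 1))) = 1 := by field_simp; ring
              rw [this, ENNReal.rpow_one]
            · simp [ENNReal.rpow_eq_zero_iff, hG0 y, hy1]
          rw [e, mul_comm]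
          gcongr
      _ = _ := by
        rw [lintegral_const_mul _ hGm, hγ]; ring
  calc _ ≤ (A ^ (p - 1) * γ ^ (-(p - 1)) * η) *
        (B ^ (1 / (p - 1)) * η ^ (-(1 / (p - 1))) * γ) ^ (p - 1) := by
        gcongr
    _ = A ^ (p - 1) * B * (γ ^ (-(p - 1)) * γ ^ (p - 1)) * (η * η⁻¹) := by
        rw [ENNReal.mul_rpow_of_nonneg _ γ hq.le,
          ENNReal.mul_rpow_of_nonneg _ (η ^ (-(1 / (p - 1)))) hq.le,
          ← ENNReal.rpow_mul, ← ENNReal.rpow_mul]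
        have i1 : 1 / (p - 1) * (p - 1) = 1 := by field_simp
        have i2 : -(1 / (p - 1)) * (p - 1) = -1 := by field_simp
        rw [i1, i2, ENNReal.rpow_one, ENNReal.rpow_neg_one]
        ring
    _ = A ^ (p - 1) * B := by
        rw [← ENNReal.rpow_add _ _ hγ0 hγT, ENNReal.mul_inv_cancel hη0 hηT]
        simp

lemma one_le_ap {n : ℕ} {p : ℝ} (hp : 1 < p) (w : Eucl n → ℝ≥0∞) (hw : IsWeight w) :
    1 ≤ apConst n p w := by
  have hq : 0 < p - 1 := by linarith
  have hp0 : 0 < p := by linarith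
  refine le_trans ?_ (le_iSup_of_le (0 : Eucl n) (le_iSup₂_of_le (1 : ℝ) one_pos le_rfl))
  have hV0 : volume (cubeSet (0 : Eucl n) 1) ≠ 0 := by
    rw [cube_vol]; exact pow_ne_zero _ (by simp)
  have hVT : volume (cubeSet (0 : Eucl n) 1) ≠ ⊤ := by
    rw [cube_vol]; exact ENNReal.pow_ne_top ENNReal.ofReal_ne_top
  set Q := cubeSet (0 : Eucl n) 1
  set V := volume Q with hV
  have hc := Real.HolderConjugate.conjExponent hp
  set p' := p.conjExponent with hp'
  have hp'e : p' = p / (p - 1) := rfl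
  have hH := ENNReal.lintegral_mul_le_Lp_mul_Lq (volume.restrict Q) hc
    (f := fun x => w x ^ (1 / p)) (g := fun x => w x ^ (-(1 / p)))
    (hw.1.pow_const _).aemeasurable (hw.1.pow_const _).aemeasurable
  have hl : ∫⁻ x in Q, ((fun x => w x ^ (1 / p)) * (fun x => w x ^ (-(1 / p)))) x = V := by
    have : ∫⁻ x in Q, (1 : ℝ≥0∞) = V := by simp [hV]
    rw [← this]
    refine lintegral_congr_ae (ae_restrict_of_ae ?_)
    filter_upwards [hw.2] with x hx
    rw [Pi.mul_apply, ← ENNReal.rpow_add _ _ hx.1.ne' hx.2.ne]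
    simp
  simp only [hl, ← ENNReal.rpow_mul] at hH
  have i1 : 1 / p * p = 1 := by field_simp
  have i2 : -(1 / p) * p' = -(1 / (p - 1)) := by rw [hp'e]; field_simp
  have i3 : 1 / p' = (p - 1) / p := by rw [hp'e]; field_simp
  simp only [i1, i2, i3, ENNReal.rpow_one] at hH
  set I := ∫⁻ y in Q, w y
  set J := ∫⁻ y in Q, w y ^ (-(1 / (p - 1)))
  have h1 : V ^ p ≤ I * J ^ (p - 1) := by
    calc V ^ p ≤ (I ^ (1 / p) * J ^ ((p - 1) / p)) ^ p := by gcongr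
      _ = _ := by
        rw [ENNReal.mul_rpow_of_nonneg _ _ hp0.le, ← ENNReal.rpow_mul, ← ENNReal.rpow_mul, i1,
          div_mul_cancel₀ _ hp0.ne', ENNReal.rpow_one]
  have hVp0 : V ^ p ≠ 0 := by simp [ENNReal.rpow_eq_zero_iff, hV0, hVT]
  have hVpT : V ^ p ≠ ⊤ := ENNReal.rpow_ne_top_of_nonneg hp0.le hVT
  calc (1 : ℝ≥0∞) = (V ^ p)⁻¹ * V ^ p := (ENNReal.inv_mul_cancel hVp0 hVpT).symm
    _ ≤ (V ^ p)⁻¹ * (I * J ^ (p - 1)) := by gcongr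
    _ = V⁻¹ * I * (V⁻¹ * J) ^ (p - 1) := by
      rw [ENNReal.mul_rpow_of_nonneg _ _ hq.le]
      have : (V ^ p)⁻¹ = V⁻¹ * V⁻¹ ^ (p - 1) := by
        have hi0 : V⁻¹ ≠ 0 := ENNReal.inv_ne_zero.2 hVT
        have hiT : V⁻¹ ≠ ⊤ := ENNReal.inv_ne_top.2 hV0
        nth_rewrite 1 [← ENNReal.rpow_one V⁻¹]
        rw [← ENNReal.rpow_add _ _ hi0 hiT, ← ENNReal.inv_rpow]
        congr 1; ring
      rw [this]; ring

lemma core_bound {n : ℕ} {ρ : (Eucl n → ℝ≥0∞) → ℝ≥0∞} (hρ : IsBBFN n ρ)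
    {p : ℝ} (hp : 1 < p) (N : ℝ → ℝ) (hN : MonotoneOn N (Set.Ici 1))
    (D D' : ℝ≥0) (hD : 0 < D) (hD' : 0 < D')
    (hM : ∀ f, Measurable f → ρ (HLM f) ≤ D * ρ f)
    (hM' : ∀ f, Measurable f → kdual n ρ (HLM f) ≤ D' * kdual n ρ f)
    (K : ℝ) (hK : K = ((((n : ℝ≥0∞) + 1) ^ n * (2 * D : ℝ≥0)) ^ (p - 1) *
      (((n : ℝ≥0∞) + 1) ^ n * (2 * D' : ℝ≥0))).toReal)
    (f g : Eucl n → ℝ) (hfg : memF n p N f g)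
    (g' : Eucl n → ℝ≥0∞) (hg' : Measurable g') (hgg' : ∀ x, (‖g x‖₊ : ℝ≥0∞) ≤ g' x)
    (hg'0 : ¬ g' =ᵐ[volume] 0) (hg'T : ρ g' ≠ ⊤)
    (h : Eucl n → ℝ≥0∞) (hh : Measurable h) (hh1 : kdual n ρ h ≤ 1) :
    ∫⁻ x, (‖f x‖₊ : ℝ≥0∞) * h x ≤ ENNReal.ofReal (N (max 1 K)) * (4 * ρ g') := by
  obtain ⟨hf, hg, hw⟩ := hfg
  have hp0 : 0 < p := by linarith
  have hq : 0 < p - 1 := by linarith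
  have hFm : Measurable (fun x => (‖f x‖₊ : ℝ≥0∞)) := enorm_meas hf
  by_cases hh0 : h =ᵐ[volume] 0
  · have : ∫⁻ x, (‖f x‖₊ : ℝ≥0∞) * h x = 0 := by
      rw [lintegral_eq_zero_iff (f := fun x => (‖f x‖₊ : ℝ≥0∞) * h x) (hFm.mul hh)]
      filter_upwards [hh0] with x hx
      simp [hx]
    rw [this]; exact bot_le
  set G := RdF D g' with hG
  set H := RdF D' h with hH
  have hGm : Measurable G := RdF_meas D hg'
  have hHm : Measurable H := RdF_meas D' hh
  have hG0 : ∀ x, G x ≠ 0 := RdF_pos D hD hg' hg'0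
  have hH0 : ∀ x, H x ≠ 0 := RdF_pos D' hD' hh hh0
  have hρG : ρ G ≤ 2 * ρ g' :=
    RdF_bound ρ D hD (fun a f hf => (hρ.smul a f hf).le) (rho_tsum hρ) hM g' hg'
  have hρH : kdual n ρ H ≤ 2 * kdual n ρ h :=
    RdF_bound (kdual n ρ) D' hD' (kdual_smul ρ) (kdual_tsum ρ) hM' h hh
  have hGT' : ρ G ≠ ⊤ := ne_top_of_le_ne_top (ENNReal.mul_ne_top (by simp) hg'T) hρG
  have hGHle : ∫⁻ x, G x * H x ≤ 4 * ρ g' := by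
    calc _ ≤ ρ G * kdual n ρ H := holder_kdual hρ G H hGm hHm hGT'
      _ ≤ (2 * ρ g') * (2 * 1) := by
        gcongr
        exact hρH.trans (by gcongr)
      _ = 4 * ρ g' := by ring
  have hGHfin : ∫⁻ x, G x * H x ≠ ⊤ :=
    ne_top_of_le_ne_top (ENNReal.mul_ne_top (by simp) hg'T) hGHle
  have hGHT : ∀ᵐ x ∂volume, G x * H x < ⊤ := ae_lt_top (hGm.mul hHm) hGHfin
  have hGT : ∀ᵐ x ∂volume, G x ≠ ⊤ := by
    filter_upwards [hGHT] with x hx hx'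
    rw [hx', ENNReal.top_mul (hH0 x)] at hx
    exact lt_irrefl _ hx
  have hHT : ∀ᵐ x ∂volume, H x ≠ ⊤ := by
    filter_upwards [hGHT] with x hx hx'
    rw [hx', ENNReal.mul_top (hG0 x)] at hx
    exact lt_irrefl _ hx
  set w : Eucl n → ℝ≥0∞ := fun x => G x ^ (1 - p) * H x with hwdef
  have hwW : IsWeight w := by
    refine ⟨(hGm.pow_const _).mul hHm, ?_⟩
    filter_upwards [hGT, hHT] with x h1 h2
    have e0 : G x ^ (1 - p) ≠ 0 := by simp [ENNReal.rpow_eq_zero_iff, hG0 x, h1]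
    have eT : G x ^ (1 - p) ≠ ⊤ := by simp [ENNReal.rpow_eq_top_iff, hG0 x, h1]
    exact ⟨pos_iff_ne_zero.2 (mul_ne_zero e0 (hH0 x)), (ENNReal.mul_ne_top eT h2).lt_top⟩
  have hap := ap_bound hp G H hGm hHm (2 * D) (2 * D') (by positivity) (by positivity)
    (HLM_RdF D hD hg') (HLM_RdF D' hD' hh) hG0 hH0 hGT hHT
  have eT : ((n : ℝ≥0∞) + 1) ^ n ≠ ⊤ := ENNReal.pow_ne_top (by simp)
  have hKT : (((n : ℝ≥0∞) + 1) ^ n * (2 * D : ℝ≥0)) ^ (p - 1) *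
      (((n : ℝ≥0∞) + 1) ^ n * (2 * D' : ℝ≥0)) ≠ ⊤ :=
    ENNReal.mul_ne_top (ENNReal.rpow_ne_top_of_nonneg hq.le
      (ENNReal.mul_ne_top eT ENNReal.coe_ne_top)) (ENNReal.mul_ne_top eT ENNReal.coe_ne_top)
  have hapT : apConst n p w ≠ ⊤ := ne_top_of_le_ne_top hKT hap
  have hap1 : 1 ≤ (apConst n p w).toReal := by
    have := ENNReal.toReal_mono hapT (one_le_ap hp w hwW)
    simpa using this
  have hapK : (apConst n p w).toReal ≤ K := by
    rw [hK]; exact ENNReal.toReal_mono hKT hap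
  have hNle : N (apConst n p w).toReal ≤ N (max 1 K) :=
    hN (Set.mem_Ici.2 hap1) (Set.mem_Ici.2 (le_max_left _ _)) (hapK.trans (le_max_right _ _))
  have hmain := hw w ⟨hwW, hapT.lt_top⟩
  have hr : wLp n p w g ≤ (∫⁻ x, G x * H x) ^ (1 / p) := by
    unfold wLp wLpE
    refine ENNReal.rpow_le_rpow ?_ (by positivity)
    refine lintegral_mono_ae ?_
    filter_upwards [hGT] with x h1
    calc (‖g x‖₊ : ℝ≥0∞) ^ p * w x ≤ G x ^ p * (G x ^ (1 - p) * H x) := by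
          simp only [hwdef]
          gcongr
          exact (hgg' x).trans (le_RdF D g' x)
      _ = G x * H x := by
        rw [← mul_assoc, ← ENNReal.rpow_add _ _ (hG0 x) h1]
        simp
  have hc := Real.HolderConjugate.conjExponent hp
  set p' := p.conjExponent with hp'
  have hp'e : p' = p / (p - 1) := rfl
  have hp'0 : 0 < p' := by rw [hp'e]; positivity
  have hHo := ENNReal.lintegral_mul_le_Lp_mul_Lq volume hc
    (f := fun x => (‖f x‖₊ : ℝ≥0∞) * w x ^ (1 / p)) (g := fun x => (G x * H x) ^ (1 / p'))
    (hFm.mul (hwW.1.pow_const _)).aemeasurable ((hGm.mul hHm).pow_const _).aemeasurable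
  have hl : ∫⁻ x, (‖f x‖₊ : ℝ≥0∞) * h x ≤
      ∫⁻ x, ((fun x => (‖f x‖₊ : ℝ≥0∞) * w x ^ (1 / p)) * (fun x => (G x * H x) ^ (1 / p'))) x := by
    refine lintegral_mono_ae ?_
    filter_upwards [hGT, hHT] with x h1 h2
    have e : w x ^ (1 / p) * (G x * H x) ^ (1 / p') = H x := by
      simp only [hwdef]
      rw [ENNReal.mul_rpow_of_nonneg _ _ (by positivity),
        ENNReal.mul_rpow_of_nonneg _ _ (by positivity), ← ENNReal.rpow_mul]
      have i1 : (1 - p) * (1 / p) + 1 / p' = 0 := by rw [hp'e]; field_simp; ring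
      have i2 : 1 / p + 1 / p' = 1 := by rw [hp'e]; field_simp; ring
      calc _ = (G x ^ ((1 - p) * (1 / p)) * G x ^ (1 / p')) * (H x ^ (1 / p) * H x ^ (1 / p')) := by
            ring
        _ = H x := by
          rw [← ENNReal.rpow_add _ _ (hG0 x) h1, ← ENNReal.rpow_add _ _ (hH0 x) h2, i1, i2]
          simp
    rw [Pi.mul_apply, mul_assoc, e]
    gcongr
    exact le_RdF D' h x
  have e1 : (∫⁻ x, ((‖f x‖₊ : ℝ≥0∞) * w x ^ (1 / p)) ^ p) ^ (1 / p) = wLp n p w f := by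
    unfold wLp wLpE
    congr 1
    refine lintegral_congr fun x => ?_
    rw [ENNReal.mul_rpow_of_nonneg _ _ hp0.le, ← ENNReal.rpow_mul, one_div_mul_cancel hp0.ne',
      ENNReal.rpow_one]
  have e2 : ∀ x, ((G x * H x) ^ (1 / p')) ^ p' = G x * H x := by
    intro x
    rw [← ENNReal.rpow_mul, one_div_mul_cancel hp'0.ne', ENNReal.rpow_one]
  simp only [e1, e2] at hHo
  calc _ ≤ _ := hl.trans hHo
    _ ≤ (ENNReal.ofReal (N (max 1 K)) * (∫⁻ x, G x * H x) ^ (1 / p)) *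
        (∫⁻ x, G x * H x) ^ (1 / p') := by
      gcongr
      refine hmain.trans ?_
      gcongr
    _ = ENNReal.ofReal (N (max 1 K)) * (∫⁻ x, G x * H x) := by
      rw [mul_assoc, ← ENNReal.rpow_add_of_nonneg _ _ (by positivity) (by positivity)]
      have i2 : 1 / p + 1 / p' = 1 := by rw [hp'e]; field_simp; ring
      rw [i2, ENNReal.rpow_one]
    _ ≤ _ := by gcongr

/-- **Theorem 1.2 (extrapolation without convexification).**
If the Hardy–Littlewood maximal operator is bounded on the ball Banach function
space `X` and on its Köthe dual `X'`, then there is `C > 0` with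
`‖f‖_X ≤ C ‖g‖_X` for every `(f,g) ∈ F(p,N)`. -/
theorem extrapolation_bbfs (n : ℕ) (hn : 1 ≤ n)
    (ρ : (Eucl n → ℝ≥0∞) → ℝ≥0∞) (hρ : IsBBFN n ρ)
    (p : ℝ) (hp : 1 < p)
    (N : ℝ → ℝ) (hN : MonotoneOn N (Set.Ici 1)) (hNpos : ∀ t, 1 ≤ t → 0 < N t)
    (hM : MBddOn n ρ) (hM' : MBddOn n (kdual n ρ)) :
    ∃ C : ℝ, 0 < C ∧ ∀ f g : Eucl n → ℝ, memF n p N f g →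
      normX ρ f ≤ ENNReal.ofReal C * normX ρ g := by
  obtain ⟨c, hc, hM⟩ := hM
  obtain ⟨c', hc', hM'⟩ := hM'
  set D : ℝ≥0 := c.toNNReal with hD
  set D' : ℝ≥0 := c'.toNNReal with hD'
  have hD0 : 0 < D := Real.toNNReal_pos.2 hc
  have hD'0 : 0 < D' := Real.toNNReal_pos.2 hc'
  obtain ⟨K, hK⟩ : ∃ K : ℝ, K = ((((n : ℝ≥0∞) + 1) ^ n * (2 * D : ℝ≥0)) ^ (p - 1) *
      (((n : ℝ≥0∞) + 1) ^ n * (2 * D' : ℝ≥0))).toReal := ⟨_, rfl⟩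
  have hN0 : 0 < N (max 1 K) := hNpos _ (le_max_left _ _)
  refine ⟨N (max 1 K) * 4, by positivity, fun f g hfg => ?_⟩
  set a : ℝ≥0∞ := ENNReal.ofReal (N (max 1 K) * 4) with ha
  have ha' : a = ENNReal.ofReal (N (max 1 K)) * 4 := by
    rw [ha, ENNReal.ofReal_mul hN0.le]; simp
  have ha0 : a ≠ 0 := by simpa [ha] using hN0
  have haT : a ≠ ⊤ := ENNReal.ofReal_ne_top
  by_cases hgT : normX ρ g = ⊤
  · rw [hgT, ENNReal.mul_top ha0]; exact le_top
  have hgm : Measurable (fun x => (‖g x‖₊ : ℝ≥0∞)) := enorm_meas hfg.2.1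
  have hfm : Measurable (fun x => (‖f x‖₊ : ℝ≥0∞)) := enorm_meas hfg.1
  let χ : Eucl n → ℝ≥0∞ := fun y =>
    (Metric.ball (0 : Eucl n) 1).indicator (fun _ => (1 : ℝ≥0∞)) y
  have hχm : Measurable χ := measurable_const.indicator measurableSet_ball
  have hχT : ρ χ ≠ ⊤ := (hρ.ball_mem 0 1 one_pos).ne
  have hχ0 : ∀ ε : ℝ≥0, 0 < ε → ¬ (fun x => (ε : ℝ≥0∞) * χ x) =ᵐ[volume] 0 := by
    intro ε hε hz
    have h1 : volume (Metric.ball (0 : Eucl n) 1) = 0 := by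
      refine measure_mono_null (fun y hy => ?_) hz
      have : χ y = 1 := Set.indicator_of_mem hy _
      simp [this, hε.ne']
    exact (Metric.measure_ball_pos volume (0 : Eucl n) one_pos).ne' h1
  have key : ∀ ε : ℝ≥0, 0 < ε → normX ρ f ≤ a * (normX ρ g + ε * ρ χ) := by
    intro ε hε
    have hεm : Measurable (fun x => (ε : ℝ≥0∞) * χ x) := hχm.const_mul _
    set g' : Eucl n → ℝ≥0∞ := fun x => (‖g x‖₊ : ℝ≥0∞) + ε * χ x with hg'
    have hg'm : Measurable g' := hgm.add hεm
    have hg'le : ρ g' ≤ normX ρ g + ε * ρ χ := by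
      refine (hρ.add_le _ _ hgm hεm).trans ?_
      rw [hρ.smul _ _ hχm]; rfl
    have hg'T : ρ g' ≠ ⊤ := ne_top_of_le_ne_top
      (ENNReal.add_ne_top.2 ⟨hgT, ENNReal.mul_ne_top ENNReal.coe_ne_top hχT⟩) hg'le
    have hg'0 : ¬ g' =ᵐ[volume] 0 := by
      intro hz
      refine hχ0 ε hε ?_
      filter_upwards [hz] with x hx
      have : (‖g x‖₊ : ℝ≥0∞) + ε * χ x = 0 := hx
      exact (add_eq_zero.1 this).2
    have hpos : ρ g' ≠ 0 := fun h0 => hg'0 ((hρ.zero_iff g' hg'm).1 h0)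
    have haT' : a * ρ g' ≠ ⊤ := ENNReal.mul_ne_top haT hg'T
    have hLL := lorentz_luxemburg hρ (fun x => (‖f x‖₊ : ℝ≥0∞)) hfm (a * ρ g').toNNReal
      (ENNReal.toNNReal_pos (mul_ne_zero ha0 hpos) haT') (by
        intro h hh hh1
        rw [ENNReal.coe_toNNReal haT', ha', mul_assoc]
        exact core_bound hρ hp N hN D D' hD0 hD'0 hM hM' K hK f g hfg g' hg'm
          (fun x => le_self_add) hg'0 hg'T h hh hh1)
    rw [ENNReal.coe_toNNReal haT'] at hLL
    refine hLL.trans ?_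
    gcongr
  have hlim : Tendsto (fun k : ℕ => a * (normX ρ g + ((((k : ℝ≥0) + 1)⁻¹ : ℝ≥0) : ℝ≥0∞) * ρ χ))
      atTop (𝓝 (a * (normX ρ g + ((0 : ℝ≥0) : ℝ≥0∞) * ρ χ))) := by
    refine ENNReal.Tendsto.const_mul (tendsto_const_nhds.add ?_) (Or.inr haT)
    refine ENNReal.Tendsto.mul_const (ENNReal.tendsto_coe.2 ?_) (Or.inr hχT)
    simpa using tendsto_one_div_add_atTop_nhds_zero_nat (𝕜 := ℝ≥0)
  have := ge_of_tendsto' hlim fun k => key (((k : ℝ≥0) + 1)⁻¹) (by positivity)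
  simpa using this
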